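/- Fix real parameters a > 0 and b ∈ (0,1). Consider the vector field G on ℝ⁴ (coordinates (r₁, ε, ρ₁, ν₁)) given by r₁' = r₁·( (1+ε)·(1 − b·r₁·(1 − 2ν₁ρ₁)) + ρ₁·r₁·ε·(a + ρ₁·r₁·ν₁²) ), ε' = −ε²·(1 − b·r₁·(1 − 2ν₁ρ₁)), ρ₁' = −ρ₁·( (1 − b·r₁·(1 − 2ν₁ρ₁)) − ρ₁·r₁·ε·(a + ρ₁·r₁·ν₁²) ), ν₁' = −ν₁·ρ₁·r₁·ε·(a + ρ₁·r₁·ν₁²). Then for every ν₁ ≥ 0 the point (0, 0, 0, ν₁) is an equilibrium of G, and the derivative of G at (0, 0, 0, ν₁) has eigenvalues 1, 0, −1, 0 (characteristic polynomial λ²(λ − 1)(λ + 1)); in particular the half-line {(0,0,0,ν₁) : ν₁ ≥ 0} is a line of partially hyperbolic saddles. -/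

import Mathlib

/-- The desingularized system in chart `𝒦₁` of the spherical blow-up of the degenerate
point of the extended Le Corbeiller system, coordinates `(r₁, ε, ρ₁, ν₁)`. -/
noncomputable def corbSphereK1Field (a b : ℝ) (p : ℝ × ℝ × ℝ × ℝ) : ℝ × ℝ × ℝ × ℝ :=
  (p.1 * ((1 + p.2.1) * (1 - b * p.1 * (1 - 2 * p.2.2.2 * p.2.2.1)) +
      p.2.2.1 * p.1 * p.2.1 * (a + p.2.2.1 * p.1 * p.2.2.2 ^ 2)),
   -p.2.1 ^ 2 * (1 - b * p.1 * (1 - 2 * p.2.2.2 * p.2.2.1)),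
   -p.2.2.1 * ((1 - b * p.1 * (1 - 2 * p.2.2.2 * p.2.2.1)) -
      p.2.2.1 * p.1 * p.2.1 * (a + p.2.2.1 * p.1 * p.2.2.2 ^ 2)),
   -p.2.2.2 * p.2.2.1 * p.1 * p.2.1 * (a + p.2.2.1 * p.1 * p.2.2.2 ^ 2))

theorem LinearMap.charpoly_smul_id_self {R : Type*} [CommRing R] [Nontrivial R] (c : R) :
    (c • (LinearMap.id : R →ₗ[R] R)).charpoly = Polynomial.X - Polynomial.C c := by
  rw [← LinearMap.charpoly_toMatrix _ (Module.Basis.singleton Unit R), Matrix.charpoly,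
    Matrix.det_unique]
  simp [Module.Basis.toMatrix_apply]

/-- If `f` vanishes at `x`, then only the derivative of `f` contributes to that of `f * g`. -/
theorem HasFDerivAt.mul_of_eq_zero {E : Type*} [NormedAddCommGroup E] [NormedSpace ℝ E]
    {f g : E → ℝ} {f' : E →L[ℝ] ℝ} {x : E} (hf : HasFDerivAt f f' x)
    (hg : DifferentiableAt ℝ g x) (h₀ : f x = 0) :
    HasFDerivAt (fun y => f y * g y) (g x • f') x :=
  (hf.mul hg.hasFDerivAt).congr_fderiv (by simp [h₀])

/-- The linearization of `corbSphereK1Field` on the line of equilibria is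
`diag (1, 0, -1, 0)`. -/
theorem hasFDerivAt_corbSphereK1Field (a b ν : ℝ) :
    HasFDerivAt (corbSphereK1Field a b)
      (((1 : ℝ) • ContinuousLinearMap.id ℝ ℝ).prodMap
        (((0 : ℝ) • ContinuousLinearMap.id ℝ ℝ).prodMap
          (((-1 : ℝ) • ContinuousLinearMap.id ℝ ℝ).prodMap
            ((0 : ℝ) • ContinuousLinearMap.id ℝ ℝ)))) (0, 0, 0, ν) := by
  have hr := hasFDerivAt_fst (𝕜 := ℝ) (p := ((0, 0, 0, ν) : ℝ × ℝ × ℝ × ℝ))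
  have hs := hasFDerivAt_snd (𝕜 := ℝ) (p := ((0, 0, 0, ν) : ℝ × ℝ × ℝ × ℝ))
  have hε := hs.fst
  have hρ := hs.snd.fst
  have h₁ := hr.mul_of_eq_zero (g := fun p => (1 + p.2.1) *
      (1 - b * p.1 * (1 - 2 * p.2.2.2 * p.2.2.1)) +
      p.2.2.1 * p.1 * p.2.1 * (a + p.2.2.1 * p.1 * p.2.2.2 ^ 2)) (by fun_prop) rfl
  have h₂ := hε.mul_of_eq_zero (g := fun p =>
      -p.2.1 * (1 - b * p.1 * (1 - 2 * p.2.2.2 * p.2.2.1))) (by fun_prop) rfl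
  have h₃ := hρ.mul_of_eq_zero (g := fun p =>
      -((1 - b * p.1 * (1 - 2 * p.2.2.2 * p.2.2.1)) -
      p.2.2.1 * p.1 * p.2.1 * (a + p.2.2.1 * p.1 * p.2.2.2 ^ 2))) (by fun_prop) rfl
  have h₄ := hρ.mul_of_eq_zero (g := fun p =>
      -p.2.2.2 * p.1 * p.2.1 * (a + p.2.2.1 * p.1 * p.2.2.2 ^ 2)) (by fun_prop) rfl
  refine ((h₁.prodMk (h₂.prodMk (h₃.prodMk h₄))).congr_of_eventuallyEq
    (.of_forall fun p => ?_)).congr_fderiv ?_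
  · ext <;> simp only [corbSphereK1Field] <;> ring
  · ext <;> simp

/-- Every point `(0,0,0,ν₁)` with `ν₁ ≥ 0` is an equilibrium whose linearization has
characteristic polynomial `λ²(λ − 1)(λ + 1)`, i.e. eigenvalues `1, 0, −1, 0`: the half-line
`{(0,0,0,ν₁) : ν₁ ≥ 0}` is a line of partially hyperbolic saddles. -/
theorem corbSphereK1_line_of_saddles (a b : ℝ) (ha : 0 < a)
    (hb : b ∈ Set.Ioo (0 : ℝ) 1) (ν₁ : ℝ) (hν₁ : 0 ≤ ν₁) :
    corbSphereK1Field a b (0, 0, 0, ν₁) = 0 ∧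
    LinearMap.charpoly
        ((fderiv ℝ (corbSphereK1Field a b) (0, 0, 0, ν₁)).toLinearMap) =
      Polynomial.X ^ 2 * (Polynomial.X - 1) * (Polynomial.X + 1) := by
  refine ⟨by simp [corbSphereK1Field], ?_⟩
  rw [(hasFDerivAt_corbSphereK1Field a b ν₁).fderiv]
  simp only [ContinuousLinearMap.coe_prodMap, ContinuousLinearMap.toLinearMap_smul,
    ContinuousLinearMap.coe_id, LinearMap.charpoly_prodMap, LinearMap.charpoly_smul_id_self,
    map_neg, map_one, map_zero]
  ring
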